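/- arXiv:2406.13116 — 3 statements merged into one kernel-verified Lean document; each statement's English description precedes it below -/
import Mathlib

section
/- In the reduction setup, E[ (1/T) Σ_{x ∈ X} Σ_{t=1}^{t_x} π^t(x) ] ≤ δ, where δ = M² e^{−nε²/2} and the expectation is over the randomness of ψ, of the sequence (u^1, …, u^T) ∼ D, and of the learner. -/
/-! ## The reduction setup -/

/-- A pure strategy of the tree-form decision problem: a choice of `i ∈ [d]`
together with, for each `j ∈ [n]`, a binary action (a sign).  Its
realization-form vector (`stratVec`) lies in `X_i ⊆ ℝ^{d×n}`. -/
abbrev Strat (d n : ℕ) := Fin d × (Fin n → Bool)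

/-- The inner product of the two vectors in `{-1/√n, 1/√n}^n` encoded by the
sign patterns `s, s' : Fin n → Bool` (`true ↦ 1/√n`, `false ↦ -1/√n`). -/
noncomputable def ip (n : ℕ) (s s' : Fin n → Bool) : ℝ :=
  ∑ j, ((if s j then 1 else -1) / Real.sqrt n) * ((if s' j then 1 else -1) / Real.sqrt n)

/-- The realization-form vector in `ℝ^{d×n}` of the pure strategy `x`: the
`x.1`-th row lies in `{-1/√n, 1/√n}^n` (signs given by `x.2`), other rows 0. -/
noncomputable def stratVec (d n : ℕ) (x : Strat d n) : Fin d → Fin n → ℝ :=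
  fun i j => if i = x.1 then (if x.2 j then 1 else -1) / Real.sqrt n else 0

/-- The standard inner product on `ℝ^{d×n}`. -/
noncomputable def dot (d n : ℕ) (v w : Fin d → Fin n → ℝ) : ℝ :=
  ∑ i, ∑ j, v i j * w i j

/-- The action set `A = A_1 ⊔ ⋯ ⊔ A_d ⊔ {a*}`, with `A_i = {a_{i1}, …, a_{iM_i}}`:
`some ⟨i, j⟩` is the action `a_{ij}` and `none` is the distinguished action `a*`. -/
abbrev Act (d : ℕ) (Mi : Fin d → ℕ) := Option ((i : Fin d) × Fin (Mi i))

/-- The sample space for the random vectors `ã_{ij}` (sign patterns, uniform). -/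
abbrev Atil (d n : ℕ) (Mi : Fin d → ℕ) := (i : Fin d) → Fin (Mi i) → Fin n → Bool

/-- The random map `ψ : A → X`, sending `a_{ij}` to `ã_{ij} ∈ X_i` and `a*` to
the fixed element `x₀`. -/
def psi {d n : ℕ} {Mi : Fin d → ℕ} (x₀ : Strat d n) (atil : Atil d n Mi) :
    Act d Mi → Strat d n
  | none => x₀
  | some p => (p.1, atil p.1 p.2)

/-- `firstTime T U a` is the first (1-indexed) iteration `t ∈ [T]` at which the
sequence `U` plays the action `a`, or `T` if this never happens. -/
noncomputable def firstTime {d : ℕ} {Mi : Fin d → ℕ} (T : ℕ) (U : Fin T → Act d Mi)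
    (a : Act d Mi) : ℕ :=
  sInf ({T} ∪ {k | ∃ t : Fin T, U t = a ∧ k = t.val + 1})

open scoped Classical in
/-- The set of indices `j` with `⟨x, ã_{x.1 j}⟩ > ε`. -/
noncomputable def goodJ {d n : ℕ} {Mi : Fin d → ℕ} (atil : Atil d n Mi) (ε : ℝ)
    (x : Strat d n) : Finset (Fin (Mi x.1)) :=
  Finset.univ.filter fun j => ε < ip n x.2 (atil x.1 j)

/-- `t_x`: if `⟨x, ã_{x.1 j}⟩ ≤ ε` for all `j`, then `t_x = 0`; otherwise
`t_x = t_{x.1 j}` for the largest `j` with `⟨x, ã_{x.1 j}⟩ > ε`. -/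
noncomputable def txOf {d n : ℕ} {Mi : Fin d → ℕ} (T : ℕ) (U : Fin T → Act d Mi)
    (atil : Atil d n Mi) (ε : ℝ) (x : Strat d n) : ℕ :=
  if h : (goodJ atil ε x).Nonempty then
    firstTime T U (some ⟨x.1, (goodJ atil ε x).max' h⟩)
  else 0

open scoped Classical in
/-- The distribution `p_x ∈ Δ(A)`: if `⟨x, ã_{x.1 j}⟩ ≤ ε` for all `j`, the
point mass on `a*`; otherwise, with `j` the largest index with
`⟨x, ã_{x.1 j}⟩ > ε` and `β = ⟨x, ã_{x.1 j}⟩`, mass `β` on `a_{x.1 j}` and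
mass `1 - β` on `a*`. -/
noncomputable def pxval {d n : ℕ} {Mi : Fin d → ℕ} (atil : Atil d n Mi) (ε : ℝ)
    (x : Strat d n) (a : Act d Mi) : ℝ :=
  if h : (goodJ atil ε x).Nonempty then
    if a = some ⟨x.1, (goodJ atil ε x).max' h⟩ then
      ip n x.2 (atil x.1 ((goodJ atil ε x).max' h))
    else if a = none then 1 - ip n x.2 (atil x.1 ((goodJ atil ε x).max' h))
    else 0
  else if a = none then 1 else 0

/-- The mixed strategy `π^t ∈ Δ(X)` played by the learner (with internal
random seed `ω`) at time `t`, as a function of the previously observed utility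
vectors `ũ^1, …, ũ^{t-1}` (where `ũ^s = ψ(u^s)`). -/
def play {d n T : ℕ} {Mi : Fin d → ℕ} {Ω : Type}
    (π : Ω → (t : Fin T) → (Fin t.val → Strat d n) → Strat d n → ℝ)
    (x₀ : Strat d n) (atil : Atil d n Mi) (ω : Ω) (U : Fin T → Act d Mi)
    (t : Fin T) : Strat d n → ℝ :=
  π ω t fun s => psi x₀ atil (U ⟨s.val, s.isLt.trans t.isLt⟩)

/-- The Chernoff bound for the inner product with a uniformly random sign vector. -/
lemma card_filter_lt_ip_le (n : ℕ) (hn : 0 < n) (ε : ℝ) (hε : 0 < ε) (s : Fin n → Bool) :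
    ∑ v : Fin n → Bool, (if ε < ip n s v then (1 : ℝ) else 0)
      ≤ (Fintype.card (Fin n → Bool) : ℝ) * Real.exp (-(n : ℝ) * ε ^ 2 / 2) := by
  have hn' : (0 : ℝ) < n := by exact_mod_cast hn
  have hip (v : Fin n → Bool) : (n : ℝ) * ε * ip n s v
      = ∑ j, ε * ((if s j then 1 else -1) * (if v j then 1 else -1)) := by
    simp only [ip, Finset.mul_sum]
    refine Finset.sum_congr rfl fun j _ => ?_
    have hsq := Real.mul_self_sqrt hn'.le
    rw [div_mul_div_comm, hsq]
    field_simp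
  have hmarkov (v : Fin n → Bool) : (if ε < ip n s v then (1 : ℝ) else 0)
      ≤ Real.exp (-(n * ε ^ 2)) * Real.exp (n * ε * ip n s v) := by
    split_ifs with h
    · rw [← Real.exp_add]
      refine Real.one_le_exp ?_
      have := mul_le_mul_of_nonneg_left h.le (by positivity : 0 ≤ (n : ℝ) * ε)
      nlinarith
    · positivity
  have hmgf : ∑ v : Fin n → Bool, Real.exp (n * ε * ip n s v) = (2 * Real.cosh ε) ^ n := by
    simp only [hip, Real.exp_sum]
    rw [← Fintype.prod_sum (fun (j : Fin n) (b : Bool) =>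
      Real.exp (ε * ((if s j then 1 else -1) * (if b then 1 else -1))))]
    rw [Finset.prod_congr rfl (g := fun _ => 2 * Real.cosh ε)]
    · simp
    · intro j _
      rw [Real.cosh_eq]
      cases s j <;> simp <;> ring
  calc _ ≤ ∑ v : Fin n → Bool, Real.exp (-(n * ε ^ 2)) * Real.exp (n * ε * ip n s v) :=
        Finset.sum_le_sum fun v _ => hmarkov v
    _ = Real.exp (-(n * ε ^ 2)) * (2 ^ n * Real.cosh ε ^ n) := by
        rw [← Finset.mul_sum, hmgf, mul_pow]
    _ ≤ Real.exp (-(n * ε ^ 2)) * (2 ^ n * Real.exp (ε ^ 2 / 2) ^ n) := by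
        gcongr
        exact Real.cosh_le_exp_half_sq ε
    _ = _ := by
        rw [← Real.exp_nat_mul, mul_left_comm, ← Real.exp_add]
        simp only [Fintype.card_pi, Fintype.card_bool, Finset.prod_const, Finset.card_univ,
          Fintype.card_fin, Nat.cast_pow, Nat.cast_ofNat]
        congr 2
        ring

/-- Resampling: a function that ignores the component `get` is uncorrelated with that
component under the uniform distribution. -/
lemma card_mul_sum_mul_get {A V : Type*} [Fintype A] [Fintype V] (get : A → V) (set : A → V → A)
    (hget : ∀ a v, get (set a v) = v) (hset : ∀ a v v', set (set a v) v' = set a v')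
    (hself : ∀ a, set a (get a) = a) (f : A → ℝ) (g : V → ℝ) (hf : ∀ a v, f (set a v) = f a) :
    (Fintype.card V : ℝ) * ∑ a, f a * g (get a) = (∑ a, f a) * ∑ v, g v := by
  let e : A × V ≃ A × V :=
    { toFun := fun p => (set p.1 p.2, get p.1)
      invFun := fun p => (set p.1 p.2, get p.1)
      left_inv := fun p => by simp [hget, hset, hself]
      right_inv := fun p => by simp [hget, hset, hself] }
  have h := e.sum_comp fun p => f p.1 * g (get p.1)
  simp only [Fintype.sum_prod_type, e, Equiv.coe_fn_mk, hf, hget] at h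
  rw [Finset.sum_mul_sum, h, Finset.mul_sum]
  simp

/-- An action not played during the first `t` rounds does not influence the learner's
strategy in round `t`. -/
lemma play_update {d n T : ℕ} {Mi : Fin d → ℕ} {Ω : Type}
    (π : Ω → (t : Fin T) → (Fin t.val → Strat d n) → Strat d n → ℝ)
    (x₀ : Strat d n) (atil : Atil d n Mi) (ω : Ω) (U : Fin T → Act d Mi) (t : Fin T)
    (i : Fin d) (j : Fin (Mi i)) (hU : ∀ s < t, U s ≠ some ⟨i, j⟩) (v : Fin n → Bool) :
    play π x₀ (Function.update atil i (Function.update (atil i) j v)) ω U t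
      = play π x₀ atil ω U t := by
  unfold play
  congr 1
  funext s
  have hs := hU ⟨s.val, s.isLt.trans t.isLt⟩ s.isLt
  cases h : U ⟨s.val, s.isLt.trans t.isLt⟩ with
  | none => rfl
  | some p =>
    obtain ⟨i', j'⟩ := p
    rw [h] at hs
    simp only [psi, Prod.mk.injEq, true_and]
    by_cases hi : i' = i
    · subst hi
      have hj : j' ≠ j := fun hj => hs (by rw [hj])
      simp [hj]
    · simp [hi]

/-- Before time `t_x`, some action whose image is well aligned with `x` is yet unplayed. -/
lemma exists_unplayed_of_lt_txOf {d n T : ℕ} {Mi : Fin d → ℕ} {U : Fin T → Act d Mi}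
    {atil : Atil d n Mi} {ε : ℝ} {x : Strat d n} {t : Fin T} (h : t.val < txOf T U atil ε x) :
    ∃ j, (∀ s < t, U s ≠ some ⟨x.1, j⟩) ∧ ε < ip n x.2 (atil x.1 j) := by
  unfold txOf at h
  split_ifs at h with hne
  · refine ⟨(goodJ atil ε x).max' hne, fun s hs hUs => ?_, ?_⟩
    · have hle : firstTime T U (some ⟨x.1, (goodJ atil ε x).max' hne⟩) ≤ s.val + 1 :=
        Nat.sInf_le (Or.inr ⟨s, hUs, rfl⟩)
      have : s.val < t.val := hs
      omega
    · have hmem := (goodJ atil ε x).max'_mem hne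
      simpa [goodJ] using hmem
  · simp at h

/-- For a fixed action sequence and round, the expected mass the learner puts on strategies
`x` with `t < t_x`. -/
lemma sum_play_before_txOf_le {d n T : ℕ} (hn : 0 < n) {Mi : Fin d → ℕ} {ε : ℝ} (hε : 0 < ε)
    (x₀ : Strat d n) {Ω : Type}
    (π : Ω → (t : Fin T) → (Fin t.val → Strat d n) → Strat d n → ℝ)
    (hπ0 : ∀ ω t h x, 0 ≤ π ω t h x) (hπ1 : ∀ ω t h, ∑ x, π ω t h x = 1)
    (ω : Ω) (U : Fin T → Act d Mi) (t : Fin T) :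
    ∑ atil : Atil d n Mi, ∑ x : Strat d n,
        (if t.val < txOf T U atil ε x then play π x₀ atil ω U t x else 0)
      ≤ (Fintype.card (Atil d n Mi) : ℝ)
          * ((∑ i, Mi i : ℕ) * Real.exp (-(n : ℝ) * ε ^ 2 / 2)) := by
  classical
  set E := Real.exp (-(n : ℝ) * ε ^ 2 / 2)
  have hplay0 (atil : Atil d n Mi) (x) : 0 ≤ play π x₀ atil ω U t x := hπ0 ..
  have hunion (atil : Atil d n Mi) (x : Strat d n) :
      (if t.val < txOf T U atil ε x then play π x₀ atil ω U t x else 0)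
      ≤ ∑ j : Fin (Mi x.1), if ∀ s < t, U s ≠ some ⟨x.1, j⟩ then
          play π x₀ atil ω U t x * (if ε < ip n x.2 (atil x.1 j) then 1 else 0) else 0 := by
    have hnonneg (j : Fin (Mi x.1)) : 0 ≤ if ∀ s < t, U s ≠ some ⟨x.1, j⟩ then
          play π x₀ atil ω U t x * (if ε < ip n x.2 (atil x.1 j) then 1 else 0) else 0 := by
      have := hplay0 atil x
      positivity
    split_ifs with h
    · obtain ⟨j, hj, hip⟩ := exists_unplayed_of_lt_txOf h
      refine le_trans ?_ (Finset.single_le_sum (fun j _ => hnonneg j) (Finset.mem_univ j))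
      rw [if_pos hj, if_pos hip, mul_one]
    · exact Finset.sum_nonneg fun j _ => hnonneg j
  have hresample (x : Strat d n) (j : Fin (Mi x.1)) :
      ∑ atil : Atil d n Mi, (if ∀ s < t, U s ≠ some ⟨x.1, j⟩ then
          play π x₀ atil ω U t x * (if ε < ip n x.2 (atil x.1 j) then 1 else 0) else 0)
      ≤ (∑ atil : Atil d n Mi, play π x₀ atil ω U t x) * E := by
    have hsum0 : 0 ≤ ∑ atil : Atil d n Mi, play π x₀ atil ω U t x :=
      Finset.sum_nonneg fun atil _ => hplay0 atil x
    by_cases hU : ∀ s < t, U s ≠ some ⟨x.1, j⟩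
    · simp only [if_pos hU]
      have hcard : (0 : ℝ) < Fintype.card (Fin n → Bool) := by
        exact_mod_cast Fintype.card_pos
      have hind := card_mul_sum_mul_get (fun a : Atil d n Mi => a x.1 j)
        (fun a v => Function.update a x.1 (Function.update (a x.1) j v))
        (by simp) (by simp) (by simp) (fun a => play π x₀ a ω U t x)
        (fun v => if ε < ip n x.2 v then 1 else 0)
        (fun a v => by rw [play_update π x₀ a ω U t x.1 j hU v])
      refine le_of_mul_le_mul_left ?_ hcard
      rw [hind, mul_left_comm]
      exact mul_le_mul_of_nonneg_left (card_filter_lt_ip_le n hn ε hε x.2) hsum0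
    · simp only [if_neg hU, Finset.sum_const_zero]
      positivity
  calc _ ≤ ∑ atil : Atil d n Mi, ∑ x : Strat d n, ∑ j : Fin (Mi x.1),
          (if ∀ s < t, U s ≠ some ⟨x.1, j⟩ then
          play π x₀ atil ω U t x * (if ε < ip n x.2 (atil x.1 j) then 1 else 0) else 0) :=
        Finset.sum_le_sum fun atil _ => Finset.sum_le_sum fun x _ => hunion atil x
    _ = ∑ x : Strat d n, ∑ j : Fin (Mi x.1), ∑ atil : Atil d n Mi,
          (if ∀ s < t, U s ≠ some ⟨x.1, j⟩ then
          play π x₀ atil ω U t x * (if ε < ip n x.2 (atil x.1 j) then 1 else 0) else 0) := by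
        rw [Finset.sum_comm]
        exact Finset.sum_congr rfl fun x _ => Finset.sum_comm
    _ ≤ ∑ x : Strat d n, ∑ _j : Fin (Mi x.1),
          (∑ atil : Atil d n Mi, play π x₀ atil ω U t x) * E :=
        Finset.sum_le_sum fun x _ => Finset.sum_le_sum fun j _ => hresample x j
    _ ≤ ∑ x : Strat d n, ((∑ i, Mi i : ℕ) : ℝ) *
          ((∑ atil : Atil d n Mi, play π x₀ atil ω U t x) * E) := by
        refine Finset.sum_le_sum fun x _ => ?_
        rw [Finset.sum_const, Finset.card_univ, Fintype.card_fin, nsmul_eq_mul]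
        have hle : Mi x.1 ≤ ∑ i, Mi i :=
          Finset.single_le_sum (fun i _ => Nat.zero_le (Mi i)) (Finset.mem_univ x.1)
        have hsum0 : 0 ≤ ∑ atil : Atil d n Mi, play π x₀ atil ω U t x :=
          Finset.sum_nonneg fun atil _ => hplay0 atil x
        refine mul_le_mul_of_nonneg_right (by exact_mod_cast hle) (by positivity)
    _ = _ := by
        rw [← Finset.mul_sum, ← Finset.sum_mul, Finset.sum_comm]
        have hone (atil : Atil d n Mi) : ∑ x, play π x₀ atil ω U t x = 1 := hπ1 ..
        simp only [hone, Finset.sum_const, Finset.card_univ, nsmul_eq_mul, mul_one]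
        ring

/-- A weighted average is at most any bound on its terms. -/
lemma sum_mul_le_of_sum_eq_one {ι : Type*} [Fintype ι] {w f : ι → ℝ} {B : ℝ}
    (hw0 : ∀ i, 0 ≤ w i) (hw1 : ∑ i, w i = 1) (hf : ∀ i, f i ≤ B) : ∑ i, w i * f i ≤ B :=
  calc ∑ i, w i * f i ≤ ∑ i, w i * B :=
        Finset.sum_le_sum fun i _ => mul_le_mul_of_nonneg_left (hf i) (hw0 i)
    _ = B := by rw [← Finset.sum_mul, hw1, one_mul]

/-!
STATEMENT 5: In the reduction setup,
`E[(1/T) ∑_{x ∈ X} ∑_{t=1}^{t_x} π^t(x)] ≤ δ  where  δ = M² e^{-nε²/2}`,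
the expectation being over the uniform random `ã` (i.e. `ψ`), the sequence
`(u^1, …, u^T) ∼ D`, and the learner's internal randomness (seed `ω ∼ w`).
Rounds are 1-indexed, so round `t.val + 1` corresponds to `t : Fin T`, and the
sum `∑_{t=1}^{t_x}` ranges over `t : Fin T` with `t.val < t_x`.
-/
theorem stmt5 (d n T M : ℕ) (hd : 0 < d) (hn : 0 < n) (hT : 0 < T)
    (Mi : Fin d → ℕ) (hM : ∑ i, Mi i = M) (ε : ℝ) (hε : 0 < ε)
    (x₀ : Strat d n)
    (D : (Fin T → Act d Mi) → ℝ)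
    (hD0 : ∀ U, 0 ≤ D U) (hD1 : ∑ U, D U = 1)
    (hsupp : ∀ U, 0 < D U → ∀ t, U t ≠ none)
    (hinc : ∀ U, 0 < D U → ∀ (t t' : Fin T) (i : Fin d) (j j' : Fin (Mi i)),
      t ≤ t' → U t = some ⟨i, j⟩ → U t' = some ⟨i, j'⟩ → j ≤ j')
    (Ω : Type) [Fintype Ω] (w : Ω → ℝ) (hw0 : ∀ ω, 0 ≤ w ω) (hw1 : ∑ ω, w ω = 1)
    (π : Ω → (t : Fin T) → (Fin t.val → Strat d n) → Strat d n → ℝ)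
    (hπ0 : ∀ ω t h x, 0 ≤ π ω t h x) (hπ1 : ∀ ω t h, ∑ x, π ω t h x = 1) :
    ∑ ω, w ω * ∑ atil : Atil d n Mi, ((Fintype.card (Atil d n Mi) : ℝ))⁻¹ *
        ∑ U, D U * ((1 / (T : ℝ)) * ∑ x : Strat d n, ∑ t : Fin T,
          if t.val < txOf T U atil ε x then play π x₀ atil ω U t x else 0)
      ≤ (M : ℝ) ^ 2 * Real.exp (-(n : ℝ) * ε ^ 2 / 2) := by
  refine sum_mul_le_of_sum_eq_one hw0 hw1 fun ω => ?_
  set C : ℝ := (Fintype.card (Atil d n Mi) : ℝ)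
  have hC : 0 < C := by
    have : 0 < Fintype.card (Atil d n Mi) := Fintype.card_pos
    exact Nat.cast_pos.mpr this
  have hT' : (0 : ℝ) < T := by exact_mod_cast hT
  have hswap : ∑ atil : Atil d n Mi, C⁻¹ *
        ∑ U, D U * ((1 / (T : ℝ)) * ∑ x : Strat d n, ∑ t : Fin T,
          if t.val < txOf T U atil ε x then play π x₀ atil ω U t x else 0)
      = ∑ U, D U * (C⁻¹ * (1 / (T : ℝ)) * ∑ t : Fin T, ∑ atil : Atil d n Mi, ∑ x : Strat d n,
          if t.val < txOf T U atil ε x then play π x₀ atil ω U t x else 0) := by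
    calc _ = ∑ atil : Atil d n Mi, ∑ U, C⁻¹ * (D U * ((1 / (T : ℝ)) * ∑ t : Fin T,
            ∑ x : Strat d n,
            if t.val < txOf T U atil ε x then play π x₀ atil ω U t x else 0)) := by
          refine Finset.sum_congr rfl fun atil _ => ?_
          rw [Finset.mul_sum]
          refine Finset.sum_congr rfl fun U _ => ?_
          rw [Finset.sum_comm]
      _ = _ := by
          rw [Finset.sum_comm]
          refine Finset.sum_congr rfl fun U _ => ?_
          rw [Finset.sum_comm (s := (Finset.univ : Finset (Fin T))), Finset.mul_sum,
            Finset.mul_sum]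
          refine Finset.sum_congr rfl fun atil _ => ?_
          ring
  rw [hswap]
  refine sum_mul_le_of_sum_eq_one hD0 hD1 fun U => ?_
  have hMM : (M : ℝ) ≤ (M : ℝ) ^ 2 := by exact_mod_cast Nat.le_self_pow two_ne_zero M
  calc _ ≤ C⁻¹ * (1 / (T : ℝ)) * ∑ _t : Fin T,
          C * ((∑ i, Mi i : ℕ) * Real.exp (-(n : ℝ) * ε ^ 2 / 2)) :=
        mul_le_mul_of_nonneg_left
          (Finset.sum_le_sum fun t _ => sum_play_before_txOf_le hn hε x₀ π hπ0 hπ1 ω U t)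
          (by positivity)
    _ = (M : ℝ) * Real.exp (-(n : ℝ) * ε ^ 2 / 2) := by
        rw [hM, Finset.sum_const, Finset.card_univ, Fintype.card_fin, nsmul_eq_mul]
        field_simp
    _ ≤ _ := by gcongr
end

section
/- In the reduction setup, for every realization of the randomness, every x ∈ X, and every time t with t_x < t ≤ T, it holds that ⟨x, ũ^t⟩ ≤ p_x(u^t) + ε. -/
theorem dot_stratVec_of_eq {d n : ℕ} (i : Fin d) (s s' : Fin n → Bool) :
    dot d n (stratVec d n (i, s)) (stratVec d n (i, s')) = ip n s s' := by
  unfold dot stratVec ip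
  rw [Finset.sum_eq_single i]
  · simp
  · intro k _ hk
    simp [hk]
  · simp

theorem dot_stratVec_of_ne {d n : ℕ} {x y : Strat d n} (h : y.1 ≠ x.1) :
    dot d n (stratVec d n x) (stratVec d n y) = 0 := by
  unfold dot stratVec
  refine Finset.sum_eq_zero fun i _ => Finset.sum_eq_zero fun j _ => ?_
  by_cases hi : i = x.1
  · simp [hi, h.symm]
  · simp [hi]

theorem mem_goodJ {d n : ℕ} {Mi : Fin d → ℕ} {atil : Atil d n Mi} {ε : ℝ}
    {x : Strat d n} {j : Fin (Mi x.1)} :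
    j ∈ goodJ atil ε x ↔ ε < ip n x.2 (atil x.1 j) := by
  simp [goodJ]

theorem pxval_some_nonneg {d n : ℕ} {Mi : Fin d → ℕ} (atil : Atil d n Mi) {ε : ℝ}
    (hε : 0 ≤ ε) (x : Strat d n) (p : (i : Fin d) × Fin (Mi i)) :
    0 ≤ pxval atil ε x (some p) := by
  unfold pxval
  split_ifs with h
  · exact hε.trans (mem_goodJ.1 ((goodJ atil ε x).max'_mem h)).le
  all_goals simp_all

theorem exists_lt_of_firstTime_lt {d T : ℕ} {Mi : Fin d → ℕ} {U : Fin T → Act d Mi}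
    {a : Act d Mi} {t : Fin T} (h : firstTime T U a < t.val + 1) :
    ∃ s, U s = a ∧ s < t := by
  have hmem : firstTime T U a ∈ ({T} ∪ {k | ∃ t : Fin T, U t = a ∧ k = t.val + 1} : Set ℕ) :=
    Nat.sInf_mem ⟨T, Or.inl rfl⟩
  rcases hmem with hT | ⟨s, hs, hk⟩
  · have := t.isLt
    rw [Set.mem_singleton_iff] at hT
    omega
  · exact ⟨s, hs, Fin.lt_def.2 (by omega)⟩

/-!
STATEMENT 6: In the reduction setup, for every realization of the randomness
(i.e. every `ã` and every sequence `U` satisfying the two support properties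
of `D`: `a*` never appears, and within each `A_i` actions appear in increasing
order of index), every `x ∈ X` and every round `t` with `t_x < t ≤ T`
(1-indexed; round `t.val + 1` corresponds to `t : Fin T`):
`⟨x, ũ^t⟩ ≤ p_x(u^t) + ε`, where `ũ^t = ψ(u^t)`.
-/
theorem stmt6 (d n T : ℕ) (Mi : Fin d → ℕ) (ε : ℝ) (hε : 0 < ε)
    (x₀ : Strat d n) (atil : Atil d n Mi)
    (U : Fin T → Act d Mi)
    (hsupp : ∀ t, U t ≠ none)
    (hinc : ∀ (t t' : Fin T) (i : Fin d) (j j' : Fin (Mi i)),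
      t ≤ t' → U t = some ⟨i, j⟩ → U t' = some ⟨i, j'⟩ → j ≤ j')
    (x : Strat d n) (t : Fin T) (ht : txOf T U atil ε x < t.val + 1) :
    dot d n (stratVec d n x) (stratVec d n (psi x₀ atil (U t)))
      ≤ pxval atil ε x (U t) + ε := by
  obtain ⟨⟨i, j⟩, hU⟩ := Option.ne_none_iff_exists'.1 (hsupp t)
  have hp : 0 ≤ pxval atil ε x (U t) := hU ▸ pxval_some_nonneg atil hε.le x ⟨i, j⟩
  obtain ⟨i', s⟩ := x
  by_cases hi : i = i'
  · subst hi
    have hdot : dot d n (stratVec d n (i, s)) (stratVec d n (psi x₀ atil (U t)))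
        = ip n s (atil i j) := by
      rw [hU]
      exact dot_stratVec_of_eq i s _
    rw [hdot]
    by_cases hj : j ∈ goodJ atil ε (i, s)
    · have hne : (goodJ atil ε (i, s)).Nonempty := ⟨j, hj⟩
      rw [txOf, dif_pos hne] at ht
      obtain ⟨r, hr, hrt⟩ := exists_lt_of_firstTime_lt ht
      have hmax : j = (goodJ atil ε (i, s)).max' hne :=
        le_antisymm (Finset.le_max' _ _ hj) (hinc r t i _ j hrt.le hr hU)
      have hpx : pxval atil ε (i, s) (U t) = ip n s (atil i j) := by
        rw [hU, pxval, dif_pos hne, if_pos (by rw [← hmax]), ← hmax]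
      linarith
    · have := not_lt.1 (mt mem_goodJ.2 hj)
      dsimp only at this
      linarith
  · have hdot : dot d n (stratVec d n (i', s)) (stratVec d n (psi x₀ atil (U t))) = 0 :=
      dot_stratVec_of_ne (by rw [hU]; exact hi)
    linarith
end

section
/- In the reduction setup, with δ = M² e^{−nε²/2}, let φ̄ : A → A be any deviation on A (possibly depending on the realized sequence (u^1, …, u^T) but not on ψ), and define the randomized deviation φ : X → conv(X) by φ(x) := E_{a ∼ p_x}[ψ(φ̄(a))]. Then E[V(φ)] ≥ E[V̄(φ̄)] − ε − 3δ, where V(φ) = (1/T) Σ_{t=1}^T Σ_{x∈X} π^t(x) ⟨φ(x), ũ^t⟩ and V̄(φ̄) = (1/T) Σ_{t=1}^T Σ_{x∈X} π^t(x) Pr_{a ∼ p_x}[φ̄(a) = u^t]. -/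
lemma ip_eq_sum_div (n : ℕ) (s s' : Fin n → Bool) :
    ip n s s' = (∑ j, if s j = s' j then (1 : ℝ) else -1) / n := by
  have hsq : Real.sqrt n * Real.sqrt n = n := Real.mul_self_sqrt n.cast_nonneg
  unfold ip
  rw [Finset.sum_div]
  refine Finset.sum_congr rfl fun j _ => ?_
  rw [div_mul_div_comm, hsq]
  cases s j <;> cases s' j <;> simp

lemma ip_self {n : ℕ} (hn : 0 < n) (s : Fin n → Bool) : ip n s s = 1 := by
  have : (n : ℝ) ≠ 0 := by positivity
  rw [ip_eq_sum_div]
  simp [this]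

lemma abs_ip_le_one (n : ℕ) (s s' : Fin n → Bool) : |ip n s s'| ≤ 1 := by
  rw [ip_eq_sum_div, abs_div, Nat.abs_cast]
  refine div_le_one_of_le₀ ((Finset.abs_sum_le_sum_abs _ _).trans ?_) n.cast_nonneg
  calc _ ≤ ∑ _j : Fin n, (1 : ℝ) := by
        refine Finset.sum_le_sum fun j _ => ?_
        split_ifs <;> simp
    _ = n := by simp

lemma dot_stratVec {d n : ℕ} (x y : Strat d n) :
    dot d n (stratVec d n x) (stratVec d n y) = if x.1 = y.1 then ip n x.2 y.2 else 0 := by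
  have h : ∀ i, ∑ j, stratVec d n x i j * stratVec d n y i j =
      if i = x.1 then (if x.1 = y.1 then ip n x.2 y.2 else 0) else 0 := by
    intro i
    unfold stratVec ip
    by_cases h1 : i = x.1
    · subst h1
      by_cases h2 : x.1 = y.1 <;> simp [h2]
    · simp [h1]
  unfold dot
  simp [h]

lemma dot_sum_smul_left {d n : ℕ} {α : Type*} [Fintype α] (p : α → ℝ)
    (v : α → Fin d → Fin n → ℝ) (u : Fin d → Fin n → ℝ) :
    dot d n (∑ a, p a • v a) u = ∑ a, p a * dot d n (v a) u := by
  simp only [dot, Finset.sum_apply, Pi.smul_apply, smul_eq_mul, Finset.sum_mul, Finset.mul_sum]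
  calc _ = ∑ i, ∑ a, ∑ j, p a * v a i j * u i j :=
        Finset.sum_congr rfl fun _ _ => Finset.sum_comm
    _ = _ := by rw [Finset.sum_comm]; simp only [mul_assoc]

lemma pxval_nonneg {d n : ℕ} {Mi : Fin d → ℕ} (atil : Atil d n Mi) {ε : ℝ} (hε : 0 < ε)
    (x : Strat d n) (a : Act d Mi) : 0 ≤ pxval atil ε x a := by
  unfold pxval
  split_ifs with h
  · have := Finset.max'_mem _ h
    simp only [goodJ, Finset.mem_filter] at this
    exact (hε.trans this.2).le
  · exact sub_nonneg.2 (abs_le.1 (abs_ip_le_one _ _ _)).2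
  all_goals norm_num

lemma sum_pxval {d n : ℕ} {Mi : Fin d → ℕ} (atil : Atil d n Mi) (ε : ℝ) (x : Strat d n) :
    ∑ a, pxval atil ε x a = 1 := by
  rw [Fintype.sum_option]
  unfold pxval
  split_ifs <;> simp_all

/-- The moment generating function bound for a uniform sign vector. -/
lemma sum_exp_ip_le {n : ℕ} (hn : 0 < n) (s : Fin n → Bool) (ε : ℝ) :
    ∑ s', Real.exp (-(n * ε * ip n s s')) ≤ 2 ^ n * Real.exp (n * ε ^ 2 / 2) := by
  have hn' : (n : ℝ) ≠ 0 := by positivity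
  have h1 : ∀ s', Real.exp (-(n * ε * ip n s s')) =
      ∏ j, Real.exp (-(ε * if s j = s' j then (1 : ℝ) else -1)) := by
    intro s'
    rw [← Real.exp_sum, ip_eq_sum_div, Finset.sum_neg_distrib, ← Finset.mul_sum]
    congr 2
    field_simp
  have h2 : ∀ j, ∑ b : Bool, Real.exp (-(ε * if s j = b then (1 : ℝ) else -1)) =
      2 * Real.cosh ε := by
    intro j
    rw [Real.cosh_eq]
    cases s j <;> simp <;> ring
  calc _ = ∏ _j : Fin n, (2 * Real.cosh ε) := by
        rw [Finset.sum_congr rfl fun s' _ => h1 s', ← Finset.prod_congr rfl fun j _ => h2 j]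
        exact (Fintype.prod_sum fun j b => Real.exp (-(ε * if s j = b then (1 : ℝ) else -1))).symm
    _ = 2 ^ n * Real.cosh ε ^ n := by simp [mul_pow]
    _ ≤ 2 ^ n * Real.exp (ε ^ 2 / 2) ^ n := by
        gcongr
        exact Real.cosh_le_exp_half_sq ε
    _ = _ := by rw [← Real.exp_nat_mul]; congr 2; ring

/-- Hoeffding's inequality for a uniform sign vector. -/
lemma sum_ip_lt_neg_le {n : ℕ} (hn : 0 < n) (s : Fin n → Bool) {ε : ℝ} (hε : 0 < ε) :
    ∑ s', (if ip n s s' < -ε then (1 : ℝ) else 0) ≤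
      2 ^ n * Real.exp (-(n : ℝ) * ε ^ 2 / 2) := by
  calc _ ≤ ∑ s', Real.exp (-(n * ε ^ 2)) * Real.exp (-(n * ε * ip n s s')) := by
        refine Finset.sum_le_sum fun s' _ => ?_
        split_ifs with h
        · rw [← Real.exp_add]
          refine Real.one_le_exp ?_
          have : 0 ≤ n * ε * (-ε - ip n s s') := by
            have : 0 ≤ -ε - ip n s s' := by linarith
            positivity
          linarith
        · positivity
    _ ≤ Real.exp (-(n * ε ^ 2)) * (2 ^ n * Real.exp (n * ε ^ 2 / 2)) := by
        rw [← Finset.mul_sum]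
        gcongr
        exact sum_exp_ip_le hn s ε
    _ = _ := by
        rw [mul_left_comm, ← Real.exp_add]
        congr 2
        ring

/-- Resampling one coordinate of a uniform random function does not change averages. -/
lemma sum_sum_update {ι S : Type*} [Fintype ι] [DecidableEq ι] [Fintype S]
    (q : ι) (f : (ι → S) → ℝ) :
    ∑ g, ∑ s, f (Function.update g q s) = Fintype.card S * ∑ g, f g := by
  let e : (ι → S) × S → (ι → S) × S := fun p => (Function.update p.1 q p.2, p.1 q)
  have he : Function.Involutive e := fun p => by simp [e]
  calc _ = ∑ p : (ι → S) × S, f (e p).1 := by rw [Fintype.sum_prod_type]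
    _ = ∑ p : (ι → S) × S, f p.1 := Equiv.sum_comp he.toPerm fun p => f p.1
    _ = _ := by simp [Fintype.sum_prod_type, Finset.mul_sum]

/-- The realized vectors of two distinct actions are rarely negatively correlated. -/
lemma sum_dot_psi_lt_neg_le {d n : ℕ} {Mi : Fin d → ℕ} (hn : 0 < n) {ε : ℝ} (hε : 0 < ε)
    (x₀ : Strat d n) (a : Act d Mi) (q : (i : Fin d) × Fin (Mi i)) (ha : a ≠ some q) :
    ∑ atil : Atil d n Mi,
      (if dot d n (stratVec d n (psi x₀ atil a)) (stratVec d n (psi x₀ atil (some q))) < -ε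
        then (1 : ℝ) else 0) ≤
      Fintype.card (Atil d n Mi) * Real.exp (-(n : ℝ) * ε ^ 2 / 2) := by
  let e : (((i : Fin d) × Fin (Mi i)) → Fin n → Bool) ≃ Atil d n Mi :=
    Equiv.piCurry fun _ _ => Fin n → Bool
  let f : Atil d n Mi → ℝ := fun atil =>
    if dot d n (stratVec d n (psi x₀ atil a)) (stratVec d n (psi x₀ atil (some q))) < -ε
      then 1 else 0
  have hS : (Fintype.card (Fin n → Bool) : ℝ) = 2 ^ n := by simp
  have hresample : ∀ g, ∑ s, f (e (Function.update g q s)) ≤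
      2 ^ n * Real.exp (-(n : ℝ) * ε ^ 2 / 2) := by
    intro g
    have hq : ∀ s, psi x₀ (e (Function.update g q s)) (some q) = (q.1, s) := by
      intro s
      simp [psi, e, Equiv.piCurry, Sigma.curry]
    have hp : ∀ s, psi x₀ (e (Function.update g q s)) a = psi x₀ (e g) a := by
      intro s
      cases a with
      | none => rfl
      | some p =>
        have hpq : p ≠ q := fun h => ha (by rw [h])
        simp [psi, e, Equiv.piCurry, Sigma.curry, hpq]
    refine le_trans (Finset.sum_le_sum fun s _ => ?_)
      (sum_ip_lt_neg_le hn (psi x₀ (e g) a).2 hε)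
    simp only [f, hq, hp, dot_stratVec]
    by_cases h : (psi x₀ (e g) a).1 = q.1
    · simp [h]
    · rw [if_neg h, if_neg (by linarith)]
      positivity
  have hsum : ∑ atil, f atil = ∑ g, f (e g) := (Equiv.sum_comp e f).symm
  have hcard : Fintype.card (Atil d n Mi) =
      Fintype.card (((i : Fin d) × Fin (Mi i)) → Fin n → Bool) := (Fintype.card_congr e).symm
  have key := sum_sum_update q fun g => f (e g)
  have hle := Finset.sum_le_sum fun g (_ : g ∈ Finset.univ) => hresample g
  rw [key, hS, Finset.sum_const, nsmul_eq_mul, Finset.card_univ, ← hcard, ← hsum] at hle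
  refine le_of_mul_le_mul_left (hle.trans_eq ?_) (by positivity : (0 : ℝ) < 2 ^ n)
  ring

open scoped Classical in
/-- The number of pairs of distinct actions whose realized vectors are negatively correlated. -/
noncomputable def badPairs {d n : ℕ} {Mi : Fin d → ℕ} (x₀ : Strat d n) (ε : ℝ)
    (atil : Atil d n Mi) : ℝ :=
  ∑ a : Act d Mi, ∑ q : (i : Fin d) × Fin (Mi i),
    if a ≠ some q ∧
      dot d n (stratVec d n (psi x₀ atil a)) (stratVec d n (psi x₀ atil (some q))) < -ε
    then 1 else 0

lemma badPairs_nonneg {d n : ℕ} {Mi : Fin d → ℕ} (x₀ : Strat d n) (ε : ℝ)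
    (atil : Atil d n Mi) : 0 ≤ badPairs x₀ ε atil := by
  refine Finset.sum_nonneg fun a _ => Finset.sum_nonneg fun q _ => ?_
  split_ifs <;> norm_num

lemma one_le_badPairs {d n : ℕ} {Mi : Fin d → ℕ} (x₀ : Strat d n) (ε : ℝ)
    (atil : Atil d n Mi) (a : Act d Mi) (q : (i : Fin d) × Fin (Mi i)) (ha : a ≠ some q)
    (h : dot d n (stratVec d n (psi x₀ atil a)) (stratVec d n (psi x₀ atil (some q))) < -ε) :
    1 ≤ badPairs x₀ ε atil := by
  classical
  let F : Act d Mi → ((i : Fin d) × Fin (Mi i)) → ℝ := fun a q =>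
    if a ≠ some q ∧
      dot d n (stratVec d n (psi x₀ atil a)) (stratVec d n (psi x₀ atil (some q))) < -ε
    then 1 else 0
  have hF : ∀ a q, 0 ≤ F a q := fun a q => by
    simp only [F]
    split_ifs <;> norm_num
  calc (1 : ℝ) = F a q := by simp only [F]; rw [if_pos ⟨ha, h⟩]
    _ ≤ ∑ q, F a q :=
        Finset.single_le_sum (f := F a) (fun q _ => hF a q) (Finset.mem_univ q)
    _ ≤ ∑ a, ∑ q, F a q :=
        Finset.single_le_sum (f := fun a => ∑ q, F a q)
          (fun a _ => Finset.sum_nonneg fun q _ => hF a q) (Finset.mem_univ a)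
    _ = badPairs x₀ ε atil := by
        unfold badPairs
        simp only [F]

lemma mean_badPairs_le {d n : ℕ} {Mi : Fin d → ℕ} (hn : 0 < n) {ε : ℝ} (hε : 0 < ε)
    (x₀ : Strat d n) :
    ∑ atil : Atil d n Mi, (Fintype.card (Atil d n Mi) : ℝ)⁻¹ * badPairs x₀ ε atil ≤
      3 * (((∑ i, Mi i : ℕ) : ℝ) ^ 2 * Real.exp (-(n : ℝ) * ε ^ 2 / 2)) := by
  classical
  set M := ∑ i, Mi i with hM
  set η := Real.exp (-(n : ℝ) * ε ^ 2 / 2)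
  have hcard : (0 : ℝ) < Fintype.card (Atil d n Mi) := by
    exact_mod_cast Fintype.card_pos
  have hsum : ∑ atil : Atil d n Mi, badPairs x₀ ε atil ≤
      ∑ _a : Act d Mi, ∑ _q : (i : Fin d) × Fin (Mi i),
        Fintype.card (Atil d n Mi) * η := by
    unfold badPairs
    rw [Finset.sum_comm]
    refine Finset.sum_le_sum fun a _ => ?_
    rw [Finset.sum_comm]
    refine Finset.sum_le_sum fun q _ => ?_
    by_cases ha : a = some q
    · simp only [ha, ne_eq, not_true_eq_false, false_and, if_false, Finset.sum_const_zero]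
      positivity
    · simpa only [ne_eq, ha, not_false_eq_true, true_and] using
        sum_dot_psi_lt_neg_le hn hε x₀ a q ha
  have hM2 : (M : ℝ) ≤ (M : ℝ) ^ 2 := by exact_mod_cast Nat.le_self_pow two_ne_zero M
  have hη : 0 < η := Real.exp_pos _
  rw [← Finset.mul_sum, inv_mul_le_iff₀ hcard]
  refine hsum.trans ?_
  simp only [Finset.sum_const, nsmul_eq_mul, Finset.card_univ, Fintype.card_option,
    Fintype.card_sigma, Fintype.card_fin, ← hM]
  push_cast
  have : ((M : ℝ) + 1) * M ≤ 3 * (M : ℝ) ^ 2 := by nlinarith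
  calc _ = ((M : ℝ) + 1) * M * (Fintype.card (Atil d n Mi) * η) := by ring
    _ ≤ 3 * (M : ℝ) ^ 2 * (Fintype.card (Atil d n Mi) * η) := by gcongr
    _ = _ := by ring

lemma dot_psi_ge {d n : ℕ} {Mi : Fin d → ℕ} (hn : 0 < n) {ε : ℝ} (hε : 0 < ε)
    (x₀ : Strat d n) (atil : Atil d n Mi) (a b : Act d Mi) (hb : b ≠ none) :
    (if a = b then 1 else 0) - (ε + badPairs x₀ ε atil) ≤
      dot d n (stratVec d n (psi x₀ atil a)) (stratVec d n (psi x₀ atil b)) := by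
  have hbad := badPairs_nonneg x₀ ε atil
  obtain ⟨q, rfl⟩ := Option.ne_none_iff_exists'.1 hb
  by_cases hab : a = some q
  · rw [if_pos hab, hab, dot_stratVec, if_pos rfl, ip_self hn]
    linarith
  · rw [if_neg hab]
    by_cases h : dot d n (stratVec d n (psi x₀ atil a))
        (stratVec d n (psi x₀ atil (some q))) < -ε
    · have h1 := one_le_badPairs x₀ ε atil a q hab h
      have h2 : -1 ≤ dot d n (stratVec d n (psi x₀ atil a))
          (stratVec d n (psi x₀ atil (some q))) := by
        rw [dot_stratVec]
        split_ifs
        · exact (abs_le.1 (abs_ip_le_one _ _ _)).1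
        · norm_num
      linarith
    · linarith

/-- Averaging preserves a uniform gap on the support of the weights. -/
lemma sum_mul_sub_le {α : Type*} [Fintype α] {p f g : α → ℝ} {c : ℝ} (hp0 : ∀ a, 0 ≤ p a)
    (hp1 : ∑ a, p a = 1) (h : ∀ a, 0 < p a → f a - c ≤ g a) :
    (∑ a, p a * f a) - c ≤ ∑ a, p a * g a := by
  calc _ = ∑ a, p a * (f a - c) := by
        simp only [mul_sub, Finset.sum_sub_distrib, ← Finset.sum_mul, hp1, one_mul]
    _ ≤ _ := by
        refine Finset.sum_le_sum fun a _ => ?_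
        rcases (hp0 a).eq_or_lt with h0 | h0
        · simp [← h0]
        · exact mul_le_mul_of_nonneg_left (h a h0) h0.le

/-!
STATEMENT 8: In the reduction setup, with `δ = M² e^{-nε²/2}`: let
`φ̄ : A → A` be any deviation on `A` (possibly depending on the realized
sequence `(u^1, …, u^T)`, but not on `ψ`; hence it is a function
`φbar : (Fin T → Act d Mi) → Act d Mi → Act d Mi` of the sequence), and define
the randomized deviation `φ : X → conv(X)` by
`φ(x) := E_{a ∼ p_x}[ψ(φ̄(a))] = ∑_a p_x(a) • ψ(φ̄(a)) ∈ ℝ^{d×n}`.  Then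
`E[V(φ)] ≥ E[V̄(φ̄)] − ε − 3δ`, where
`V(φ) = (1/T) ∑_t ∑_x π^t(x) ⟨φ(x), ũ^t⟩` and
`V̄(φ̄) = (1/T) ∑_t ∑_x π^t(x) Pr_{a ∼ p_x}[φ̄(a) = u^t]`.  The expectation is
over the uniform random `ã`, the sequence `(u^1, …, u^T) ∼ D`, and the
learner's seed.
-/
theorem stmt8 (d n T M : ℕ) (hd : 0 < d) (hn : 0 < n) (hT : 0 < T)
    (Mi : Fin d → ℕ) (hM : ∑ i, Mi i = M) (ε : ℝ) (hε : 0 < ε)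
    (x₀ : Strat d n)
    (D : (Fin T → Act d Mi) → ℝ)
    (hD0 : ∀ U, 0 ≤ D U) (hD1 : ∑ U, D U = 1)
    (hsupp : ∀ U, 0 < D U → ∀ t, U t ≠ none)
    (hinc : ∀ U, 0 < D U → ∀ (t t' : Fin T) (i : Fin d) (j j' : Fin (Mi i)),
      t ≤ t' → U t = some ⟨i, j⟩ → U t' = some ⟨i, j'⟩ → j ≤ j')
    (Ω : Type) [Fintype Ω] (w : Ω → ℝ) (hw0 : ∀ ω, 0 ≤ w ω) (hw1 : ∑ ω, w ω = 1)
    (π : Ω → (t : Fin T) → (Fin t.val → Strat d n) → Strat d n → ℝ)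
    (hπ0 : ∀ ω t h x, 0 ≤ π ω t h x) (hπ1 : ∀ ω t h, ∑ x, π ω t h x = 1)
    (φbar : (Fin T → Act d Mi) → Act d Mi → Act d Mi) :
    ∑ ω, w ω * ∑ atil : Atil d n Mi, ((Fintype.card (Atil d n Mi) : ℝ))⁻¹ *
        ∑ U, D U * ((1 / (T : ℝ)) * ∑ t : Fin T, ∑ x : Strat d n,
          play π x₀ atil ω U t x *
            dot d n (∑ a : Act d Mi, pxval atil ε x a • stratVec d n (psi x₀ atil (φbar U a)))
              (stratVec d n (psi x₀ atil (U t))))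
      ≥ (∑ ω, w ω * ∑ atil : Atil d n Mi, ((Fintype.card (Atil d n Mi) : ℝ))⁻¹ *
          ∑ U, D U * ((1 / (T : ℝ)) * ∑ t : Fin T, ∑ x : Strat d n,
            play π x₀ atil ω U t x *
              ∑ a : Act d Mi, pxval atil ε x a * (if φbar U a = U t then 1 else 0)))
        - ε - 3 * ((M : ℝ) ^ 2 * Real.exp (-(n : ℝ) * ε ^ 2 / 2)) := by
  have hT' : (0 : ℝ) < T := by exact_mod_cast hT
  refine ge_iff_le.2 (le_trans (le_of_eq (sub_sub _ _ _)) ?_)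
  refine sum_mul_sub_le hw0 hw1 fun ω _ => ?_
  have hcard : (Fintype.card (Atil d n Mi) : ℝ) ≠ 0 := by
    exact_mod_cast Fintype.card_ne_zero
  have hmean := mean_badPairs_le (Mi := Mi) hn hε x₀
  rw [hM] at hmean
  have hconst : ∑ _atil : Atil d n Mi, (Fintype.card (Atil d n Mi) : ℝ)⁻¹ * ε = ε := by
    rw [Finset.sum_const, nsmul_eq_mul, Finset.card_univ, mul_inv_cancel_left₀ hcard]
  refine (sub_le_sub_left (add_le_add hconst.le hmean) _).trans ?_
  rw [← Finset.sum_add_distrib, ← Finset.sum_sub_distrib]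
  refine Finset.sum_le_sum fun atil _ => ?_
  rw [← mul_add, ← mul_sub]
  refine mul_le_mul_of_nonneg_left ?_ (by positivity)
  refine sum_mul_sub_le hD0 hD1 fun U hU => ?_
  rw [Finset.mul_sum, Finset.mul_sum]
  refine sum_mul_sub_le (fun _ => by positivity) (by simp [hT'.ne']) fun t _ => ?_
  refine sum_mul_sub_le (fun x => hπ0 _ _ _ x) (hπ1 _ _ _) fun x _ => ?_
  rw [dot_sum_smul_left]
  exact sum_mul_sub_le (pxval_nonneg atil hε x) (sum_pxval atil ε x) fun a _ =>
    dot_psi_ge hn hε x₀ atil _ _ (hsupp U hU t)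
end
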